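/- Existence of a common degenerate direction (Theorem B.2, part 1). Suppose Assumption 1 holds, 𝓕 is convex, and r₁(·;θ) is F-integrable for every F ∈ 𝓕. Fix θ ∈ Θ. Suppose 𝓕'_θ is nonempty and that there exists no F ∈ 𝓕 with ∫ r₁(z;θ) dF = 0 and inf_{λ ∈ 𝒮₂} ∫ γ₂(λ,z;θ) dF > 0. Then dim(r₂) ≥ 1 and there exists λ̃ ∈ 𝒮₂ such that ∫ γ₂(λ̃,z;θ) dF = 0 for every F ∈ 𝓕'_θ. -/

import Mathlib

open MeasureTheory Set
open scoped ENNReal RealInnerProductSpace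

noncomputable section

/-- The positive part of an extended real, as an extended nonnegative real. -/
def EReal.posPart (x : EReal) : ℝ≥0∞ := if x = ⊤ then ⊤ else ENNReal.ofReal x.toReal

/-- The integral of an `EReal`-valued function: the integral of its positive part
minus the integral of its negative part (an element of `EReal`). -/
def integralEReal {𝓩 : Type*} [MeasurableSpace 𝓩] (F : Measure 𝓩) (f : 𝓩 → EReal) : EReal :=
  ((∫⁻ z, (f z).posPart ∂F : ℝ≥0∞) : EReal) - ((∫⁻ z, (-(f z)).posPart ∂F : ℝ≥0∞) : EReal)

variable {𝓤 𝓩 : Type*}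
  [MeasurableSpace 𝓤] [TopologicalSpace 𝓤] [PolishSpace 𝓤] [BorelSpace 𝓤]
  [MeasurableSpace 𝓩] [TopologicalSpace 𝓩] [PolishSpace 𝓩] [BorelSpace 𝓩]
  {Θ : Type*}

/-- The section `Γ(z;θ) = {u : (u,z) ∈ Γ(θ)}`. -/
def sectionSet (Γθ : Set (𝓤 × 𝓩)) (z : 𝓩) : Set 𝓤 := {u | (u, z) ∈ Γθ}

/-- The set `𝓡(z;θ)` of moment values consistent with the support restriction at `z`. -/
def momentSet {d : ℕ} (Γθ : Set (𝓤 × 𝓩)) (rθ : 𝓤 → 𝓩 → EuclideanSpace ℝ (Fin d)) (z : 𝓩) :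
    Set (EuclideanSpace ℝ (Fin d)) := (fun u => rθ u z) '' sectionSet Γθ z

/-- The support function `γ(λ,z;θ) = sup {λᵀt : t ∈ 𝓡(z;θ)}`, with values in `EReal`. -/
def suppFun {d : ℕ} (Γθ : Set (𝓤 × 𝓩)) (rθ : 𝓤 → 𝓩 → EuclideanSpace ℝ (Fin d))
    (l : EuclideanSpace ℝ (Fin d)) (z : 𝓩) : EReal :=
  sSup ((fun t => ((⟪l, t⟫ : ℝ) : EReal)) '' momentSet Γθ rθ z)

/-- Assumption 1 at a single parameter value and a single distribution. -/
structure Assumption1At {d : ℕ} (F : Measure 𝓩) (Γθ : Set (𝓤 × 𝓩))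
    (rθ : 𝓤 → 𝓩 → EuclideanSpace ℝ (Fin d)) : Prop where
  borel_Gamma : MeasurableSet Γθ
  nonempty_section : ∀ z, (sectionSet Γθ z).Nonempty
  borel_section : ∀ z, MeasurableSet (sectionSet Γθ z)
  measurable_r : Measurable fun p : 𝓤 × 𝓩 => rθ p.1 p.2
  lower_envelope : ∃ g : 𝓩 → ℝ, Measurable g ∧ Integrable g F ∧
    ∀ᵐ z ∂F, sInf (norm '' momentSet Γθ rθ z) ≤ g z

/-- Assumption 1: measurability, nonempty sections, and an integrable lower envelope for
the infimum of the norm over the moment set. -/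
def Assumption1 {d : ℕ} (𝓕 : Set (Measure 𝓩)) (Γ : Θ → Set (𝓤 × 𝓩))
    (r : Θ → 𝓤 → 𝓩 → EuclideanSpace ℝ (Fin d)) : Prop :=
  ∀ θ : Θ, ∀ F ∈ 𝓕, Assumption1At F (Γ θ) (r θ)

/-- Assumption 2 at a single parameter value and distribution: closedness and
integrable boundedness of the moment sets. -/
structure Assumption2At {d : ℕ} (F : Measure 𝓩) (Γθ : Set (𝓤 × 𝓩))
    (rθ : 𝓤 → 𝓩 → EuclideanSpace ℝ (Fin d)) : Prop where
  closed_momentSet : ∀ᵐ z ∂F, IsClosed (momentSet Γθ rθ z)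
  upper_envelope : ∃ g : 𝓩 → ℝ, Measurable g ∧ Integrable g F ∧
    ∀ᵐ z ∂F, ∀ t ∈ momentSet Γθ rθ z, ‖t‖ ≤ g z

/-- Assumption 2 (closedness and integrable boundedness). -/
def Assumption2 {d : ℕ} (𝓕 : Set (Measure 𝓩)) (Γ : Θ → Set (𝓤 × 𝓩))
    (r : Θ → 𝓤 → 𝓩 → EuclideanSpace ℝ (Fin d)) : Prop :=
  ∀ θ : Θ, ∀ F ∈ 𝓕, Assumption2At F (Γ θ) (r θ)

/-- `θ` belongs to the identified set `Θ_I(F)`: there is a Borel probability measure `H`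
on `𝓤 × 𝓩` giving probability one to the support restriction, with `𝓩`-marginal `F`,
under which the moment function is integrable with mean zero. -/
def MemIdentified {d : ℕ} (Γθ : Set (𝓤 × 𝓩)) (rθ : 𝓤 → 𝓩 → EuclideanSpace ℝ (Fin d))
    (F : Measure 𝓩) : Prop :=
  ∃ H : Measure (𝓤 × 𝓩), IsProbabilityMeasure H ∧ H Γθ = 1 ∧ H.map Prod.snd = F ∧
    Integrable (fun p : 𝓤 × 𝓩 => rθ p.1 p.2) H ∧ (∫ p : 𝓤 × 𝓩, rθ p.1 p.2 ∂H) = 0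

/-- `θ` belongs to the moment closure `Θ̄_I(F)` of the identified set. -/
def MemMomentClosure {d : ℕ} (Γθ : Set (𝓤 × 𝓩)) (rθ : 𝓤 → 𝓩 → EuclideanSpace ℝ (Fin d))
    (F : Measure 𝓩) : Prop :=
  ∀ ε : ℝ, 0 < ε → ∃ H : Measure (𝓤 × 𝓩), IsProbabilityMeasure H ∧ H Γθ = 1 ∧
    H.map Prod.snd = F ∧ Integrable (fun p : 𝓤 × 𝓩 => rθ p.1 p.2) H ∧
    ‖∫ p : 𝓤 × 𝓩, rθ p.1 p.2 ∂H‖ ≤ ε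

/-- `θ` belongs to the support-function set `Θ̃(F)`:
`∫ γ(λ,z;θ) dF ≥ 0` for every `λ` in the unit sphere. -/
def MemSFSet {d : ℕ} (Γθ : Set (𝓤 × 𝓩)) (rθ : 𝓤 → 𝓩 → EuclideanSpace ℝ (Fin d))
    (F : Measure 𝓩) : Prop :=
  ∀ l : EuclideanSpace ℝ (Fin d), ‖l‖ = 1 → (0 : EReal) ≤ integralEReal F (suppFun Γθ rθ l)


/-- The combined moment function `r(u,z;θ) = (r₁(z;θ), r₂(u,z;θ))`, where `r₁` collects the
components that do not depend on the latent variable `u`. -/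
def rComb {d1 d2 : ℕ} (r1θ : 𝓩 → EuclideanSpace ℝ (Fin d1))
    (r2θ : 𝓤 → 𝓩 → EuclideanSpace ℝ (Fin d2)) (u : 𝓤) (z : 𝓩) :
    EuclideanSpace ℝ (Fin (d1 + d2)) :=
  (EuclideanSpace.equiv (Fin (d1 + d2)) ℝ).symm
    (Fin.append (EuclideanSpace.equiv (Fin d1) ℝ (r1θ z))
      (EuclideanSpace.equiv (Fin d2) ℝ (r2θ u z)))

/-- The partial support function `γ₂(λ,z;θ) = sup {λᵀ r₂(u,z;θ) : u ∈ Γ(z;θ)}`. -/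
def suppFun2 {d2 : ℕ} (Γθ : Set (𝓤 × 𝓩)) (r2θ : 𝓤 → 𝓩 → EuclideanSpace ℝ (Fin d2))
    (l : EuclideanSpace ℝ (Fin d2)) (z : 𝓩) : EReal :=
  sSup ((fun u => ((⟪l, r2θ u z⟫ : ℝ) : EReal)) '' sectionSet Γθ z)

/-- Convexity of a family of (probability) measures. -/
def ConvexFamily (𝓕 : Set (Measure 𝓩)) : Prop :=
  ∀ F₁ ∈ 𝓕, ∀ F₂ ∈ 𝓕, ∀ δ : ℝ, 0 ≤ δ → δ ≤ 1 →
    (ENNReal.ofReal δ • F₁ + ENNReal.ofReal (1 - δ) • F₂) ∈ 𝓕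

/-- Finite-sample indistinguishability of the hypotheses `θ ∈ Θ_I(F)` and `θ ∈ Θ̄_I(F)`:
for every sample size `n` and every (measurable, `[0,1]`-valued) test `φ`, the supremum of the
rejection probability over `𝓕_θ` equals the supremum over `𝓕̄_θ`. -/
def Indistinguishable {d : ℕ} (𝓕 : Set (Measure 𝓩)) (Γθ : Set (𝓤 × 𝓩))
    (rθ : 𝓤 → 𝓩 → EuclideanSpace ℝ (Fin d)) : Prop :=
  ∀ (n : ℕ) (φ : (Fin n → 𝓩) → ℝ), Measurable φ → (∀ x, φ x ∈ Set.Icc (0 : ℝ) 1) →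
    sSup ((fun F : Measure 𝓩 => ∫ x, φ x ∂(Measure.pi fun _ : Fin n => F)) ''
        {F ∈ 𝓕 | MemIdentified Γθ rθ F}) =
      sSup ((fun F : Measure 𝓩 => ∫ x, φ x ∂(Measure.pi fun _ : Fin n => F)) ''
        {F ∈ 𝓕 | MemMomentClosure Γθ rθ F})

/-- For a finite measure, the measure of a continuous image of the Baire space is approximated
from below by the measures of compact subsets. -/
theorem exists_isCompact_subset_range_le_measure {X : Type*} [TopologicalSpace X]
    [MeasurableSpace X] (μ : Measure X) [μ.OuterRegular] {f : (ℕ → ℕ) → X}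
    (hf : Continuous f) {c : ℝ≥0∞} (hc : c < μ (range f)) :
    ∃ K ⊆ range f, IsCompact K ∧ c ≤ μ K := by
  have step : ∀ (S : Set (ℕ → ℕ)) (n : ℕ), ∃ k : ℕ,
      c < μ (f '' S) → c < μ (f '' (S ∩ {y | y n ≤ k})) := by
    intro S n
    by_cases h : c < μ (f '' S)
    · have hmono : Monotone fun k : ℕ => f '' (S ∩ {y | y n ≤ k}) := fun a b hab =>
        image_mono (inter_subset_inter_right _ fun y (hy : y n ≤ a) => hy.trans hab)
      have hU : f '' S = ⋃ k : ℕ, f '' (S ∩ {y | y n ≤ k}) := by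
        rw [← image_iUnion, ← inter_iUnion]
        congr 1
        exact (inter_eq_left.2 fun y _ => mem_iUnion.2 ⟨y n, le_refl (y n)⟩).symm
      rw [hU, hmono.measure_iUnion] at h
      obtain ⟨k, hk⟩ := lt_iSup_iff.1 h
      exact ⟨k, fun _ => hk⟩
    · exact ⟨0, fun h' => absurd h' h⟩
  choose k hk using step
  let S : ℕ → Set (ℕ → ℕ) := fun n =>
    Nat.rec univ (fun n T => T ∩ {y | y n ≤ k T n}) n
  let x : ℕ → ℕ := fun n => k (S n) n
  have hSlt : ∀ n, c < μ (f '' S n) := by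
    intro n
    induction n with
    | zero => simpa [S] using hc
    | succ n ih => exact hk (S n) n ih
  have hSx : ∀ n, ∀ y ∈ S n, ∀ i < n, y i ≤ x i := by
    intro n
    induction n with
    | zero => simp
    | succ n ih =>
      intro y hy i hi
      rcases Nat.lt_succ_iff_lt_or_eq.1 hi with h | rfl
      · exact ih y hy.1 i h
      · exact hy.2
  have hK : IsCompact (univ.pi fun i => Iic (x i)) :=
    isCompact_univ_pi fun i => (finite_Iic (x i)).isCompact
  refine ⟨f '' univ.pi fun i => Iic (x i), image_subset_range _ _, hK.image hf, ?_⟩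
  by_contra! hlt
  obtain ⟨U, hKU, hU, hUc⟩ := Set.exists_isOpen_lt_of_lt _ _ hlt
  let : MetricSpace (ℕ → ℕ) := PiNat.metricSpaceNatNat
  obtain ⟨δ, hδ, hδU⟩ :=
    hK.exists_thickening_subset_open (hU.preimage hf) (image_subset_iff.1 hKU)
  obtain ⟨n, hn⟩ := exists_pow_lt_of_lt_one hδ (by norm_num : (1 / 2 : ℝ) < 1)
  refine (hSlt n).not_ge ((measure_mono (image_subset_iff.2 fun y hy => hδU ?_)).trans hUc.le)
  rw [Metric.mem_thickening_iff]
  refine ⟨fun i => min (y i) (x i), fun i _ => min_le_right (y i) (x i), lt_of_le_of_lt ?_ hn⟩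
  rw [← PiNat.mem_cylinder_iff_dist_le, PiNat.mem_cylinder_iff]
  exact fun i hi => (min_eq_left (hSx n y hy i hi)).symm

/-- Analytic sets are universally measurable. -/
theorem MeasureTheory.AnalyticSet.nullMeasurableSet {X : Type*} [TopologicalSpace X] [T2Space X]
    [MeasurableSpace X] [OpensMeasurableSpace X] (μ : Measure X) [IsFiniteMeasure μ]
    [μ.OuterRegular] {s : Set X} (hs : AnalyticSet s) : NullMeasurableSet s μ := by
  rw [AnalyticSet] at hs
  rcases hs with rfl | ⟨f, hf, rfl⟩
  · exact nullMeasurableSet_empty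
  rcases eq_or_ne (μ (range f)) 0 with h0 | h0
  · exact NullMeasurableSet.of_null h0
  obtain ⟨u, -, hu, hlim⟩ := exists_seq_strictMono_tendsto' (pos_iff_ne_zero.2 h0)
  choose K hKs hK hKu using fun n =>
    exists_isCompact_subset_range_le_measure μ hf (hu n).2
  have hmeas : MeasurableSet (⋃ n, K n) := .iUnion fun n => (hK n).isClosed.measurableSet
  refine hmeas.nullMeasurableSet.congr
    (ae_eq_of_subset_of_measure_ge (iUnion_subset hKs) ?_ hmeas.nullMeasurableSet
      (measure_ne_top μ _))
  exact le_of_tendsto' hlim fun n => (hKu n).trans (measure_mono (subset_iUnion K n))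

/-- Lower semicontinuity passes through the Lebesgue integral (Fatou's lemma). -/
theorem lowerSemicontinuous_lintegral {X α : Type*} [TopologicalSpace X]
    [FirstCountableTopology X] [MeasurableSpace α] {μ : Measure α} {h : X → α → ℝ≥0∞}
    (hm : ∀ x, AEMeasurable (h x) μ) (hl : ∀ a, LowerSemicontinuous fun x => h x a) :
    LowerSemicontinuous fun x => ∫⁻ a, h x a ∂μ := by
  refine lowerSemicontinuous_iff_le_liminf.2 fun x => ?_
  exact (lintegral_mono fun a => lowerSemicontinuous_iff_le_liminf.1 (hl a) x).trans
    (lintegral_liminf_le' hm)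

theorem EReal.toENNReal_add_ofReal {a : EReal} {b : ℝ} (hb : 0 ≤ b) (hab : -(b : EReal) ≤ a) :
    a.toENNReal + ENNReal.ofReal b = (a + b).toENNReal + (-a).toENNReal := by
  induction a with
  | bot => simp at hab
  | top => simp
  | coe a =>
    have hab : -b ≤ a := by exact_mod_cast hab
    rw [← EReal.coe_add, ← EReal.coe_neg]
    simp only [EReal.toENNReal_of_ne_top (EReal.coe_ne_top _), EReal.toReal_coe]
    rcases le_total 0 a with h | h
    · rw [ENNReal.ofReal_of_nonpos (p := -a) (by linarith), ENNReal.ofReal_add h hb, add_zero]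
    · rw [ENNReal.ofReal_of_nonpos h, ← ENNReal.ofReal_add (by linarith) (by linarith)]
      simp

/-- A function bounded below by an integrable function has finite negative part. -/
theorem lintegral_posPart_neg_ne_top {α : Type*} [MeasurableSpace α] {F : Measure α}
    {f : α → EReal} {g : α → ℝ} (hg : Integrable g F) (hfg : ∀ᵐ z ∂F, -(g z : EReal) ≤ f z) :
    ∫⁻ z, (-(f z)).posPart ∂F ≠ ⊤ := by
  refine ne_top_of_le_ne_top hg.lintegral_lt_top.ne (lintegral_mono_ae ?_)
  filter_upwards [hfg] with z hz
  exact EReal.toENNReal_le_toENNReal (EReal.neg_le_of_neg_le hz)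

/-- Shifting by an integrable envelope turns `integralEReal` into a Lebesgue integral up to a
constant. -/
theorem integralEReal_eq_lintegral_add_sub {α : Type*} [MeasurableSpace α] {F : Measure α}
    {f : α → EReal} {g : α → ℝ} (hf : AEMeasurable f F) (hgm : Measurable g)
    (hg : Integrable g F) (hg0 : ∀ᵐ z ∂F, 0 ≤ g z) (hfg : ∀ᵐ z ∂F, -(g z : EReal) ≤ f z) :
    integralEReal F f = ((∫⁻ z, (f z + g z).toENNReal ∂F : ℝ≥0∞) : EReal)
      - ((∫⁻ z, ENNReal.ofReal (g z) ∂F : ℝ≥0∞) : EReal) := by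
  have hN := lintegral_posPart_neg_ne_top hg hfg
  have hG : ∫⁻ z, ENNReal.ofReal (g z) ∂F ≠ ⊤ := hg.lintegral_lt_top.ne
  have hNm : AEMeasurable (fun z => (-(f z)).posPart) F :=
    measurable_ereal_toENNReal.comp_aemeasurable hf.neg
  have key : ∫⁻ z, (f z).posPart ∂F + ∫⁻ z, ENNReal.ofReal (g z) ∂F =
      ∫⁻ z, (f z + g z).toENNReal ∂F + ∫⁻ z, (-(f z)).posPart ∂F := by
    rw [← lintegral_add_right _ hgm.ennreal_ofReal,
      ← lintegral_add_right' _ hNm]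
    refine lintegral_congr_ae ?_
    filter_upwards [hg0, hfg] with z h0 hz
    exact EReal.toENNReal_add_ofReal h0 hz
  unfold integralEReal
  generalize ∫⁻ z, (-(f z)).posPart ∂F = N at *
  generalize ∫⁻ z, ENNReal.ofReal (g z) ∂F = G at *
  generalize ∫⁻ z, (f z).posPart ∂F = P at *
  generalize ∫⁻ z, (f z + g z).toENNReal ∂F = H at *
  lift N to NNReal using hN
  lift G to NNReal using hG
  induction P with
  | top =>
    have : H = ⊤ := by simpa using key.symm
    simp [this]
  | coe P =>
    induction H with
    | top => simp at key
    | coe H =>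
      have h : (P : ℝ) + G = H + N := by exact_mod_cast key
      have : (P : ℝ) - N = H - G := by linarith
      change ((P : ℝ) : EReal) - ((N : ℝ) : EReal) = ((H : ℝ) : EReal) - ((G : ℝ) : EReal)
      exact_mod_cast congrArg Real.toEReal this

theorem integralEReal_nonneg_iff {α : Type*} [MeasurableSpace α] {F : Measure α} {f : α → EReal}
    (hN : ∫⁻ z, (-(f z)).posPart ∂F ≠ ⊤) :
    0 ≤ integralEReal F f ↔ ∫⁻ z, (-(f z)).posPart ∂F ≤ ∫⁻ z, (f z).posPart ∂F := by
  rw [integralEReal, EReal.sub_nonneg (.inr (by simpa using hN)) (.inr (by simp)),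
    EReal.coe_ennreal_le_coe_ennreal_iff]

theorem integralEReal_nonpos_iff {α : Type*} [MeasurableSpace α] {F : Measure α} {f : α → EReal} :
    integralEReal F f ≤ 0 ↔ ∫⁻ z, (f z).posPart ∂F ≤ ∫⁻ z, (-(f z)).posPart ∂F := by
  rw [integralEReal, EReal.sub_nonpos, EReal.coe_ennreal_le_coe_ennreal_iff]

theorem integralEReal_coe {α : Type*} [MeasurableSpace α] {F : Measure α} {f : α → ℝ}
    (hf : Integrable f F) :
    integralEReal F (fun z => (f z : EReal)) = ((∫ z, f z ∂F : ℝ) : EReal) := by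
  have hP : ∫⁻ z, ENNReal.ofReal (f z) ∂F ≠ ⊤ := hf.lintegral_lt_top.ne
  have hN : ∫⁻ z, ENNReal.ofReal (-f z) ∂F ≠ ⊤ := hf.neg.lintegral_lt_top.ne
  rw [integral_eq_lintegral_pos_part_sub_lintegral_neg_part hf, EReal.coe_sub,
    EReal.coe_ennreal_toReal hP, EReal.coe_ennreal_toReal hN]
  simp [integralEReal, EReal.posPart, ← EReal.coe_neg]

/-- Integrals against a mixture of two measures. -/
theorem lintegral_mix {α : Type*} [MeasurableSpace α] (F₁ F₂ : Measure α) (a b : ℝ≥0∞)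
    (f : α → ℝ≥0∞) :
    ∫⁻ z, f z ∂(a • F₁ + b • F₂) = a * ∫⁻ z, f z ∂F₁ + b * ∫⁻ z, f z ∂F₂ := by
  rw [lintegral_add_measure, lintegral_smul_measure, lintegral_smul_measure, smul_eq_mul,
    smul_eq_mul]

section Mixture

variable {α : Type*} [MeasurableSpace α] {F₁ F₂ : Measure α} {f : α → EReal} {a b : ℝ≥0∞}

theorem integralEReal_mix_nonneg (ha : a ≠ ⊤) (hb : b ≠ ⊤)
    (hN₁ : ∫⁻ z, (-(f z)).posPart ∂F₁ ≠ ⊤) (hN₂ : ∫⁻ z, (-(f z)).posPart ∂F₂ ≠ ⊤)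
    (h₁ : 0 ≤ integralEReal F₁ f) (h₂ : 0 ≤ integralEReal F₂ f) :
    0 ≤ integralEReal (a • F₁ + b • F₂) f := by
  rw [integralEReal_nonneg_iff (by rw [lintegral_mix]; finiteness), lintegral_mix, lintegral_mix]
  rw [integralEReal_nonneg_iff hN₁] at h₁
  rw [integralEReal_nonneg_iff hN₂] at h₂
  gcongr

theorem integralEReal_nonpos_left_of_mix (ha : a ≠ ⊤) (ha0 : a ≠ 0) (hb : b ≠ ⊤)
    (hN₂ : ∫⁻ z, (-(f z)).posPart ∂F₂ ≠ ⊤)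
    (h₂ : 0 ≤ integralEReal F₂ f) (h : integralEReal (a • F₁ + b • F₂) f ≤ 0) :
    integralEReal F₁ f ≤ 0 := by
  rw [integralEReal_nonpos_iff, lintegral_mix,
    lintegral_mix] at h
  rw [integralEReal_nonneg_iff hN₂] at h₂
  rw [integralEReal_nonpos_iff, ← ENNReal.mul_le_mul_iff_right ha0 ha]
  refine (ENNReal.add_le_add_iff_right (a := b * ∫⁻ z, (-(f z)).posPart ∂F₂)
    (by finiteness)).1 (le_trans ?_ h)
  gcongr

end Mixture

/-- Concatenation of vectors of Euclidean spaces. -/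
def euclideanAppend {m n : ℕ} (x : EuclideanSpace ℝ (Fin m)) (y : EuclideanSpace ℝ (Fin n)) :
    EuclideanSpace ℝ (Fin (m + n)) :=
  WithLp.toLp 2 (Fin.append x.ofLp y.ofLp)

theorem inner_euclideanAppend {m n : ℕ} (x x' : EuclideanSpace ℝ (Fin m))
    (y y' : EuclideanSpace ℝ (Fin n)) :
    ⟪euclideanAppend x y, euclideanAppend x' y'⟫ = ⟪x, x'⟫ + ⟪y, y'⟫ := by
  simp [euclideanAppend, PiLp.inner_apply, Fin.sum_univ_add]

theorem norm_euclideanAppend_sq {m n : ℕ} (x : EuclideanSpace ℝ (Fin m))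
    (y : EuclideanSpace ℝ (Fin n)) : ‖euclideanAppend x y‖ ^ 2 = ‖x‖ ^ 2 + ‖y‖ ^ 2 := by
  simp only [← real_inner_self_eq_norm_sq, inner_euclideanAppend]

theorem rComb_eq_euclideanAppend {U Z : Type*} {d1 d2 : ℕ} (r1 : Z → EuclideanSpace ℝ (Fin d1))
    (r2 : U → Z → EuclideanSpace ℝ (Fin d2)) (u : U) (z : Z) :
    rComb r1 r2 u z = euclideanAppend (r1 z) (r2 u z) := rfl

theorem suppFun_rComb {U Z : Type*} {d1 d2 : ℕ} (Γθ : Set (U × Z))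
    (r1 : Z → EuclideanSpace ℝ (Fin d1))
    (r2 : U → Z → EuclideanSpace ℝ (Fin d2)) (x : EuclideanSpace ℝ (Fin d1))
    (y : EuclideanSpace ℝ (Fin d2)) (z : Z) :
    suppFun Γθ (rComb r1 r2) (euclideanAppend x y) z =
      sSup ((fun u => ((⟪x, r1 z⟫ + ⟪y, r2 u z⟫ : ℝ) : EReal)) '' sectionSet Γθ z) := by
  simp only [suppFun, momentSet, image_image, rComb_eq_euclideanAppend, inner_euclideanAppend]

theorem MemSFSet.integralEReal_suppFun2_nonneg
    {U Z : Type*} [MeasurableSpace Z] {d1 d2 : ℕ} {Γθ : Set (U × Z)}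
    {r1 : Z → EuclideanSpace ℝ (Fin d1)} {r2 : U → Z → EuclideanSpace ℝ (Fin d2)}
    {F : Measure Z} (h : MemSFSet Γθ (rComb r1 r2) F) {l : EuclideanSpace ℝ (Fin d2)}
    (hl : ‖l‖ = 1) : 0 ≤ integralEReal F (suppFun2 Γθ r2 l) := by
  have hn : ‖euclideanAppend (0 : EuclideanSpace ℝ (Fin d1)) l‖ = 1 := by
    have := norm_euclideanAppend_sq (0 : EuclideanSpace ℝ (Fin d1)) l
    rw [hl] at this
    exact (sq_eq_sq₀ (norm_nonneg _) zero_le_one).1 (by simpa using this)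
  have hs : suppFun Γθ (rComb r1 r2) (euclideanAppend 0 l) = suppFun2 Γθ r2 l := by
    ext z
    rw [suppFun_rComb]
    simp [suppFun2]
  exact hs ▸ h _ hn

theorem MemSFSet.integral_eq_zero {U Z : Type*} [MeasurableSpace Z] {d1 d2 : ℕ} {Γθ : Set (U × Z)}
    {r1 : Z → EuclideanSpace ℝ (Fin d1)} {r2 : U → Z → EuclideanSpace ℝ (Fin d2)}
    {F : Measure Z} (h : MemSFSet Γθ (rComb r1 r2) F)
    (hΓ : ∀ z, (sectionSet Γθ z).Nonempty) (hr1 : Integrable r1 F) : ∫ z, r1 z ∂F = 0 := by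
  by_contra hm
  set m := ∫ z, r1 z ∂F with hmdef
  have hm0 : 0 < ‖m‖ := norm_pos_iff.2 hm
  let l : EuclideanSpace ℝ (Fin d1) := -(‖m‖⁻¹ • m)
  have hl : ‖l‖ = 1 := by
    simp [l, norm_smul, hm0.ne']
  have hn : ‖euclideanAppend l (0 : EuclideanSpace ℝ (Fin d2))‖ = 1 := by
    have := norm_euclideanAppend_sq l (0 : EuclideanSpace ℝ (Fin d2))
    rw [hl] at this
    exact (sq_eq_sq₀ (norm_nonneg _) zero_le_one).1 (by simpa using this)
  have hs : suppFun Γθ (rComb r1 r2) (euclideanAppend l 0) =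
      fun z => ((⟪l, r1 z⟫ : ℝ) : EReal) := by
    ext z
    rw [suppFun_rComb]
    simp [(hΓ z).image_const]
  have h0 := h _ hn
  rw [hs, integralEReal_coe (hr1.const_inner l), integral_inner hr1, ← hmdef] at h0
  have h0 : 0 ≤ ⟪l, m⟫ := by exact_mod_cast h0
  simp only [l, inner_neg_left, real_inner_smul_left, real_inner_self_eq_norm_sq] at h0
  have : 0 < ‖m‖⁻¹ * ‖m‖ ^ 2 := by positivity
  linarith

theorem neg_le_suppFun2_of_sInf_le {U Z : Type*} {d1 d2 : ℕ} {Γθ : Set (U × Z)}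
    {r1 : Z → EuclideanSpace ℝ (Fin d1)} {r2 : U → Z → EuclideanSpace ℝ (Fin d2)} {z : Z}
    (hΓ : (sectionSet Γθ z).Nonempty) {b : ℝ}
    (hb : sInf (norm '' momentSet Γθ (rComb r1 r2) z) ≤ b) {l : EuclideanSpace ℝ (Fin d2)}
    (hl : ‖l‖ = 1) : -(b : EReal) ≤ suppFun2 Γθ r2 l z := by
  by_contra! hlt
  obtain ⟨c, hc, hcb⟩ := EReal.lt_iff_exists_real_btwn.1 hlt
  have hcb : c < -b := by exact_mod_cast hcb
  obtain ⟨_, ⟨_, ⟨u, hu, rfl⟩, rfl⟩, hlt'⟩ :=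
    exists_lt_of_csInf_lt ((hΓ.image _).image _) (lt_of_le_of_lt hb (lt_neg_of_lt_neg hcb))
  have h1 : ‖r2 u z‖ ≤ ‖rComb r1 r2 u z‖ := by
    refine le_of_sq_le_sq ?_ (norm_nonneg _)
    rw [rComb_eq_euclideanAppend, norm_euclideanAppend_sq]
    nlinarith [sq_nonneg ‖r1 z‖]
  have h2 := neg_le_of_abs_le (abs_real_inner_le_norm l (r2 u z))
  rw [hl, one_mul] at h2
  have h3 : ((⟪l, r2 u z⟫ : ℝ) : EReal) < c := (le_sSup (mem_image_of_mem _ hu)).trans_lt hc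
  have h3 : ⟪l, r2 u z⟫ < c := by exact_mod_cast h3
  have hlt' : ‖rComb r1 r2 u z‖ < -c := hlt'
  linarith

theorem measurable_snd_of_measurable_rComb
    {U Z : Type*} [MeasurableSpace U] [MeasurableSpace Z] {d1 d2 : ℕ}
    {r1 : Z → EuclideanSpace ℝ (Fin d1)}
    {r2 : U → Z → EuclideanSpace ℝ (Fin d2)}
    (h : Measurable fun p : U × Z => rComb r1 r2 p.1 p.2) :
    Measurable fun p : U × Z => r2 p.1 p.2 := by
  refine Measurable.comp (WithLp.measurable_toLp 2 _)
    (f := fun p : U × Z => (r2 p.1 p.2).ofLp) (measurable_pi_lambda _ fun i => ?_)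
  have := (measurable_pi_apply (Fin.natAdd d1 i)).comp ((WithLp.measurable_ofLp 2 _).comp h)
  simpa [Function.comp_def, rComb_eq_euclideanAppend, euclideanAppend] using this

/-- The partial support function is universally measurable. -/
theorem aemeasurable_suppFun2 {d2 : ℕ} {Γθ : Set (𝓤 × 𝓩)} (hΓ : MeasurableSet Γθ)
    {r2 : 𝓤 → 𝓩 → EuclideanSpace ℝ (Fin d2)}
    (hr2 : Measurable fun p : 𝓤 × 𝓩 => r2 p.1 p.2) (F : Measure 𝓩) [IsFiniteMeasure F]
    (l : EuclideanSpace ℝ (Fin d2)) : AEMeasurable (suppFun2 Γθ r2 l) F := by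
  refine NullMeasurable.aemeasurable ?_
  refine measurable_of_Ioi (δ := NullMeasurableSpace 𝓩 F) fun c => ?_
  have himg : suppFun2 Γθ r2 l ⁻¹' Ioi c =
      Prod.snd '' (Γθ ∩ {p : 𝓤 × 𝓩 | c < ((⟪l, r2 p.1 p.2⟫ : ℝ) : EReal)}) := by
    ext z
    simp [suppFun2, lt_sSup_iff, sectionSet]
  have hms : MeasurableSet (Γθ ∩ {p : 𝓤 × 𝓩 | c < ((⟪l, r2 p.1 p.2⟫ : ℝ) : EReal)}) :=
    hΓ.inter (measurableSet_lt measurable_const (hr2.const_inner).coe_real_ereal)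
  have : NullMeasurableSet (suppFun2 Γθ r2 l ⁻¹' Ioi c) F :=
    himg ▸ (hms.analyticSet_image measurable_snd).nullMeasurableSet F
  exact this

theorem lowerSemicontinuous_suppFun2 {U Z : Type*} {d2 : ℕ} (Γθ : Set (U × Z))
    (r2 : U → Z → EuclideanSpace ℝ (Fin d2)) (z : Z) :
    LowerSemicontinuous fun l => suppFun2 Γθ r2 l z := by
  simp only [suppFun2, sSup_image]
  refine lowerSemicontinuous_biSup fun u _ => Continuous.lowerSemicontinuous ?_
  exact continuous_coe_real_ereal.comp (continuous_id.inner continuous_const)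

theorem lowerSemicontinuous_lintegral_suppFun2_add {d2 : ℕ} {Γθ : Set (𝓤 × 𝓩)}
    (hΓ : MeasurableSet Γθ) {r2 : 𝓤 → 𝓩 → EuclideanSpace ℝ (Fin d2)}
    (hr2 : Measurable fun p : 𝓤 × 𝓩 => r2 p.1 p.2) (F : Measure 𝓩) [IsFiniteMeasure F]
    {g : 𝓩 → ℝ} (hg : Measurable g) :
    LowerSemicontinuous fun l => ∫⁻ z, (suppFun2 Γθ r2 l z + g z).toENNReal ∂F := by
  refine lowerSemicontinuous_lintegral (fun l => ?_) fun z => ?_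
  · exact measurable_ereal_toENNReal.comp_aemeasurable
      ((aemeasurable_suppFun2 hΓ hr2 F l).add hg.coe_real_ereal.aemeasurable)
  · have hc : Continuous fun x : EReal => (x + g z).toENNReal :=
      EReal.continuous_toENNReal.comp <| continuous_iff_continuousAt.2 fun x =>
        (EReal.continuousAt_add (p := (x, (g z : EReal))) (.inr (by simp)) (.inr (by simp))).comp
          (f := fun x : EReal => (x, (g z : EReal))) (by fun_prop)
    exact hc.comp_lowerSemicontinuous (lowerSemicontinuous_suppFun2 Γθ r2 z)
      fun x y hxy => EReal.toENNReal_le_toENNReal (add_le_add_left hxy _)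

theorem Assumption1At.exists_envelope {U Z : Type*}
    [MeasurableSpace U] [MeasurableSpace Z] {d1 d2 : ℕ} {F : Measure Z} {Γθ : Set (U × Z)}
    {r1 : Z → EuclideanSpace ℝ (Fin d1)} {r2 : U → Z → EuclideanSpace ℝ (Fin d2)}
    (h : Assumption1At F Γθ (rComb r1 r2)) :
    ∃ g : Z → ℝ, Measurable g ∧ Integrable g F ∧ (∀ᵐ z ∂F, 0 ≤ g z) ∧
      ∀ l : EuclideanSpace ℝ (Fin d2), ‖l‖ = 1 →
        ∀ᵐ z ∂F, -(g z : EReal) ≤ suppFun2 Γθ r2 l z := by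
  obtain ⟨g, hgm, hgi, hg⟩ := h.lower_envelope
  refine ⟨g, hgm, hgi, ?_, fun l hl => ?_⟩
  · filter_upwards [hg] with z hz
    refine le_trans (Real.sInf_nonneg ?_) hz
    rintro _ ⟨t, -, rfl⟩
    exact norm_nonneg t
  · filter_upwards [hg] with z hz
    exact neg_le_suppFun2_of_sInf_le (h.nonempty_section z) hz hl

theorem Assumption1At.lintegral_posPart_neg_suppFun2_ne_top {U Z : Type*}
    [MeasurableSpace U] [MeasurableSpace Z] {d1 d2 : ℕ} {F : Measure Z}
    {Γθ : Set (U × Z)} {r1 : Z → EuclideanSpace ℝ (Fin d1)}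
    {r2 : U → Z → EuclideanSpace ℝ (Fin d2)} (h : Assumption1At F Γθ (rComb r1 r2))
    {l : EuclideanSpace ℝ (Fin d2)} (hl : ‖l‖ = 1) :
    ∫⁻ z, (-(suppFun2 Γθ r2 l z)).posPart ∂F ≠ ⊤ := by
  obtain ⟨g, -, hgi, -, hg⟩ := h.exists_envelope
  exact lintegral_posPart_neg_ne_top hgi (hg l hl)

theorem Assumption1At.lowerSemicontinuousOn_integralEReal_suppFun2 {d1 d2 : ℕ} {F : Measure 𝓩}
    [IsFiniteMeasure F] {Γθ : Set (𝓤 × 𝓩)} {r1 : 𝓩 → EuclideanSpace ℝ (Fin d1)}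
    {r2 : 𝓤 → 𝓩 → EuclideanSpace ℝ (Fin d2)} (h : Assumption1At F Γθ (rComb r1 r2)) :
    LowerSemicontinuousOn (fun l => integralEReal F (suppFun2 Γθ r2 l)) (Metric.sphere 0 1) := by
  obtain ⟨g, hgm, hgi, hg0, hg⟩ := h.exists_envelope
  have hr2 := measurable_snd_of_measurable_rComb h.measurable_r
  have hG : ∫⁻ z, ENNReal.ofReal (g z) ∂F ≠ ⊤ := hgi.lintegral_lt_top.ne
  have hc : Continuous fun x : ℝ≥0∞ =>
      (x : EReal) - ((∫⁻ z, ENNReal.ofReal (g z) ∂F : ℝ≥0∞) : EReal) := by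
    simp only [sub_eq_add_neg]
    refine continuous_iff_continuousAt.2 fun x => ?_
    exact (EReal.continuousAt_add (p := ((x : EReal), _)) (.inr (by simpa using hG))
      (.inl (by simp))).comp (f := fun x : ℝ≥0∞ => ((x : EReal), _))
      (continuous_coe_ennreal_ereal.prodMk continuous_const).continuousAt
  have hlsc := hc.comp_lowerSemicontinuous
    (lowerSemicontinuous_lintegral_suppFun2_add h.borel_Gamma hr2 F hgm)
    fun x y hxy => EReal.sub_le_sub (EReal.coe_ennreal_le_coe_ennreal_iff.2 hxy) le_rfl
  have heq : ∀ l ∈ Metric.sphere (0 : EuclideanSpace ℝ (Fin d2)) 1, _ := fun l hl =>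
    integralEReal_eq_lintegral_add_sub (aemeasurable_suppFun2 h.borel_Gamma hr2 F l) hgm hgi
      hg0 (hg l (mem_sphere_zero_iff_norm.1 hl))
  intro l hl c hlc
  simp only [heq l hl] at hlc
  filter_upwards [hlsc.lowerSemicontinuousOn _ l hl c hlc, self_mem_nhdsWithin] with l' hl' hl's
  rw [heq l' hl's]
  exact hl'

/-- **Theorem B.2, part 1 (existence of a common degenerate direction).**
Suppose Assumption 1 holds, `𝓕` is convex, and `r₁(·;θ)` is `F`-integrable for every `F ∈ 𝓕`.
Fix `θ ∈ Θ`.  Suppose `𝓕'_θ = {F ∈ 𝓕 : ∫ γ(λ,z;θ) dF ≥ 0 for all λ ∈ 𝒮}` is nonempty and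
there exists no `F ∈ 𝓕` with `∫ r₁(z;θ) dF = 0` and `inf_{λ ∈ 𝒮₂} ∫ γ₂(λ,z;θ) dF > 0`.
Then `dim r₂ ≥ 1` and there exists `λ̃ ∈ 𝒮₂` with `∫ γ₂(λ̃,z;θ) dF = 0` for every
`F ∈ 𝓕'_θ`. -/
theorem common_degenerate_direction {d1 d2 : ℕ}
    (𝓕 : Set (Measure 𝓩)) (hprob : ∀ F ∈ 𝓕, IsProbabilityMeasure F)
    (hconv : ConvexFamily 𝓕)
    (Γ : Θ → Set (𝓤 × 𝓩)) (r1 : Θ → 𝓩 → EuclideanSpace ℝ (Fin d1))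
    (r2 : Θ → 𝓤 → 𝓩 → EuclideanSpace ℝ (Fin d2))
    (h1 : Assumption1 𝓕 Γ (fun θ => rComb (r1 θ) (r2 θ)))
    (hr1int : ∀ F ∈ 𝓕, ∀ θ : Θ, Integrable (r1 θ) F)
    (θ : Θ)
    (hne : ({F ∈ 𝓕 | MemSFSet (Γ θ) (rComb (r1 θ) (r2 θ)) F}).Nonempty)
    (hno : ¬ ∃ F ∈ 𝓕, (∫ z, r1 θ z ∂F) = 0 ∧
      (0 : EReal) < ⨅ l : {l : EuclideanSpace ℝ (Fin d2) // ‖l‖ = 1},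
        integralEReal F (suppFun2 (Γ θ) (r2 θ) l.1)) :
    1 ≤ d2 ∧ ∃ lt : EuclideanSpace ℝ (Fin d2), ‖lt‖ = 1 ∧
      ∀ F ∈ 𝓕, MemSFSet (Γ θ) (rComb (r1 θ) (r2 θ)) F →
        integralEReal F (suppFun2 (Γ θ) (r2 θ) lt) = 0 := by
  set 𝓖 : Set (Measure 𝓩) := {F ∈ 𝓕 | (∫ z, r1 θ z ∂F) = 0 ∧
    ∀ l : EuclideanSpace ℝ (Fin d2), ‖l‖ = 1 →
      0 ≤ integralEReal F (suppFun2 (Γ θ) (r2 θ) l)}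
  have hsub : ∀ F ∈ 𝓕, MemSFSet (Γ θ) (rComb (r1 θ) (r2 θ)) F → F ∈ 𝓖 := fun F hF hS =>
    ⟨hF, hS.integral_eq_zero (h1 θ F hF).nonempty_section (hr1int F hF θ),
      fun l hl => hS.integralEReal_suppFun2_nonneg hl⟩
  have hNtop : ∀ F ∈ 𝓕, ∀ l : EuclideanSpace ℝ (Fin d2), ‖l‖ = 1 →
      ∫⁻ z, (-(suppFun2 (Γ θ) (r2 θ) l z)).posPart ∂F ≠ ⊤ := fun F hF l hl =>
    (h1 θ F hF).lintegral_posPart_neg_suppFun2_ne_top hl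
  let S : Set (EuclideanSpace ℝ (Fin d2)) := Metric.sphere 0 1
  have hS : ∀ {l}, l ∈ S ↔ ‖l‖ = 1 := mem_sphere_zero_iff_norm
  have hScomp : IsCompact S := isCompact_sphere 0 1
  obtain ⟨F₀, hF₀⟩ : 𝓖.Nonempty := hne.imp fun F hF => hsub F hF.1 hF.2
  have hSne : S.Nonempty := by
    by_contra hE
    refine hno ⟨F₀, hF₀.1, hF₀.2.1, ?_⟩
    have : IsEmpty {l : EuclideanSpace ℝ (Fin d2) // ‖l‖ = 1} :=
      ⟨fun l => hE ⟨l.1, hS.2 l.2⟩⟩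
    rw [iInf_of_empty]
    exact EReal.zero_lt_top
  have hd2 : 1 ≤ d2 := by
    obtain ⟨l, hl⟩ := hSne
    rcases Nat.eq_zero_or_pos d2 with rfl | h
    · simp [Subsingleton.elim l 0, hS] at hl
    · exact h
  refine ⟨hd2, ?_⟩
  let Z : 𝓖 → Set (EuclideanSpace ℝ (Fin d2)) := fun F =>
    {l ∈ S | integralEReal F (suppFun2 (Γ θ) (r2 θ) l) ≤ 0}
  have hZcomp : ∀ F, IsCompact (Z F) := fun F => by
    have := hprob F F.2.1
    exact (h1 θ F F.2.1).lowerSemicontinuousOn_integralEReal_suppFun2.isCompact_inter_preimage_Iic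
      hScomp 0
  have hZne : ∀ F, (Z F).Nonempty := fun F => by
    have := hprob F F.2.1
    obtain ⟨l, hl, hmin⟩ := LowerSemicontinuousOn.exists_isMinOn hSne hScomp
      (h1 θ F F.2.1).lowerSemicontinuousOn_integralEReal_suppFun2
    refine ⟨l, hl, not_lt.1 fun hpos => hno ⟨F, F.2.1, F.2.2.1, hpos.trans_le ?_⟩⟩
    exact le_iInf fun l' => hmin (hS.2 l'.2)
  have hdir : Directed (· ⊇ ·) Z := fun F₁ F₂ => by
    obtain ⟨F₁, hF₁, hr₁, hp₁⟩ := F₁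
    obtain ⟨F₂, hF₂, hr₂, hp₂⟩ := F₂
    have hmix := hconv F₁ hF₁ F₂ hF₂ (1 / 2) (by norm_num) (by norm_num)
    rw [show (1 - 1 / 2 : ℝ) = 1 / 2 by norm_num] at hmix
    have hc : ENNReal.ofReal (1 / 2) ≠ ⊤ := ENNReal.ofReal_ne_top
    have hc0 : ENNReal.ofReal (1 / 2) ≠ 0 := by simp
    generalize ENNReal.ofReal (1 / 2) = c at hmix hc hc0
    have hrmix : ∫ z, r1 θ z ∂(c • F₁ + c • F₂) = 0 := by
      rw [integral_add_measure ((hr1int F₁ hF₁ θ).smul_measure hc)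
        ((hr1int F₂ hF₂ θ).smul_measure hc), integral_smul_measure, integral_smul_measure,
        hr₁, hr₂]
      simp
    refine ⟨⟨c • F₁ + c • F₂, hmix, hrmix, fun l hl => integralEReal_mix_nonneg hc hc
      (hNtop F₁ hF₁ l hl) (hNtop F₂ hF₂ l hl) (hp₁ l hl) (hp₂ l hl)⟩, fun l hl => ?_,
      fun l hl => ?_⟩
    · have hl1 := hS.1 hl.1
      exact ⟨hl.1, integralEReal_nonpos_left_of_mix hc hc0 hc (hNtop F₂ hF₂ l hl1)
        (hp₂ l hl1) hl.2⟩
    · have hl1 := hS.1 hl.1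
      exact ⟨hl.1, integralEReal_nonpos_left_of_mix hc hc0 hc (hNtop F₁ hF₁ l hl1)
        (hp₁ l hl1) (add_comm (c • F₁) (c • F₂) ▸ hl.2)⟩
  have : Nonempty 𝓖 := ⟨⟨F₀, hF₀⟩⟩
  obtain ⟨l, hl⟩ := IsCompact.nonempty_iInter_of_directed_nonempty_isCompact_isClosed Z hdir hZne
    hZcomp fun F => (hZcomp F).isClosed
  rw [mem_iInter] at hl
  have hl1 : ‖l‖ = 1 := hS.1 (hl ⟨F₀, hF₀⟩).1
  exact ⟨l, hl1, fun F hF hSF => le_antisymm (hl ⟨F, hsub F hF hSF⟩).2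
    (hSF.integralEReal_suppFun2_nonneg hl1)⟩

end
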